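/- Let T : C → C be ρ-Lipschitz (ρ > 0) on a nonempty convex subset C of a real normed space and let x⁰ ∈ C with T x⁰ ≠ x⁰. Define the ada-halpern iteration: β₀ = 0, R₀ = 1, κ̂₀ = ‖x⁰ − T x⁰‖, and for n ≥ 1: β_n = B_ρ(R_{n−1}), x^n = (1−β_n)x⁰ + β_n T x^{n−1}, κ̂_n = max{κ̂_{n−1}, ‖x⁰ − T x^n‖}, R_n = 1 − β_n + β_n ‖T x^n − T x^{n−1}‖/κ̂_n. Then for all n ≥ 1: β_n ≥ β_{n−1}, r_ρ ≤ R_n ≤ V_ρ(R_{n−1}) ≤ R_{n−1}, and ‖x^n − T x^n‖ ≤ κ̂_n R_n ≤ κ̂_n R*_n, where R*_n is the minimax-optimal bound (R*₀ = 1, R*_n = V_ρ(R*_{n−1})). -/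

import Mathlib

/-- `V_ρ(r) = min_{β ∈ [0,1]} (1 - β + ρβ² + ρβ(r-1))`. -/
noncomputable def Vq (ρ r : ℝ) : ℝ :=
  sInf ((fun b : ℝ => 1 - b + ρ * b ^ 2 + ρ * b * (r - 1)) '' Set.Icc 0 1)

/-- `B_ρ(r) = min{1, (1/ρ + 1 - r)/2}`, the minimizer of the quadratic over `[0,1]`. -/
noncomputable def Bq (ρ r : ℝ) : ℝ := min 1 ((1 / ρ + 1 - r) / 2)

/-- The minimax-optimal bounds: `R*₀ = 1`, `R*_n = V_ρ(R*_{n-1})`. -/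
noncomputable def RStar (ρ : ℝ) : ℕ → ℝ
  | 0 => 1
  | n + 1 => Vq ρ (RStar ρ n)

lemma Vq_bddBelow (ρ r : ℝ) :
    BddBelow ((fun b : ℝ => 1 - b + ρ * b ^ 2 + ρ * b * (r - 1)) '' Set.Icc 0 1) := by
  refine (isCompact_Icc.image ?_).bddBelow
  fun_prop

lemma Vq_le (ρ r : ℝ) {b : ℝ} (hb0 : 0 ≤ b) (hb1 : b ≤ 1) :
    Vq ρ r ≤ 1 - b + ρ * b ^ 2 + ρ * b * (r - 1) :=
  csInf_le (Vq_bddBelow ρ r) ⟨b, ⟨hb0, hb1⟩, rfl⟩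

lemma le_Vq {ρ r c : ℝ}
    (h : ∀ b : ℝ, 0 ≤ b → b ≤ 1 → c ≤ 1 - b + ρ * b ^ 2 + ρ * b * (r - 1)) :
    c ≤ Vq ρ r := by
  refine le_csInf ((Set.nonempty_Icc.2 zero_le_one).image _) ?_
  rintro _ ⟨b, ⟨hb0, hb1⟩, rfl⟩
  exact h b hb0 hb1

lemma Vq_mono {ρ : ℝ} (hρ : 0 < ρ) : Monotone (Vq ρ) := fun r s hrs =>
  le_Vq fun b hb0 hb1 => (Vq_le ρ r hb0 hb1).trans <| by gcongr

lemma Vq_le_self (ρ : ℝ) {r : ℝ} (h0 : 0 ≤ r) (h1 : r ≤ 1) : Vq ρ r ≤ r := by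
  have h := Vq_le ρ r (b := 1 - r) (by linarith) (by linarith)
  linarith [show 1 - (1 - r) + ρ * (1 - r) ^ 2 + ρ * (1 - r) * (r - 1) = r by ring]

lemma Bq_antitone (ρ : ℝ) : Antitone (Bq ρ) := fun r s hrs => by
  unfold Bq
  gcongr

lemma Bq_nonneg {ρ : ℝ} (hρ : 0 < ρ) {r : ℝ} (h : r ≤ 1) : 0 ≤ Bq ρ r := by
  have : 0 < 1 / ρ := by positivity
  exact le_min zero_le_one (by linarith)

/-- `Bq ρ r` minimizes the quadratic defining `Vq ρ r`. -/
lemma quadratic_Bq_le_Vq {ρ : ℝ} (hρ : 0 < ρ) (r : ℝ) :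
    1 - Bq ρ r + ρ * Bq ρ r ^ 2 + ρ * Bq ρ r * (r - 1) ≤ Vq ρ r := by
  refine le_Vq fun b _ hb1 => ?_
  obtain ⟨m, hm⟩ : ∃ m, m = (1 / ρ + 1 - r) / 2 := ⟨_, rfl⟩
  have hq (c : ℝ) : 1 - c + ρ * c ^ 2 + ρ * c * (r - 1) = 1 + ρ * (c ^ 2 - 2 * m * c) := by
    rw [hm]
    field_simp
    ring
  rw [hq, hq, Bq, ← hm]
  gcongr 1 + ρ * ?_
  rcases le_total 1 m with h | h
  · rw [min_eq_left h]
    nlinarith [mul_nonneg (sub_nonneg.2 hb1) (sub_nonneg.2 h)]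
  · rw [min_eq_right h]
    nlinarith [sq_nonneg (b - m)]

/-- ada-halpern: with `β₀ = 0`, `R₀ = 1`, `κ̂₀ = ‖x⁰ - T x⁰‖`, and for `n ≥ 1`
`β_n = B_ρ(R_{n-1})`, `x^n = (1-β_n) x⁰ + β_n T x^{n-1}`,
`κ̂_n = max{κ̂_{n-1}, ‖x⁰ - T x^n‖}`, `R_n = 1 - β_n + β_n ‖T x^n - T x^{n-1}‖/κ̂_n`,
one has for all `n ≥ 1`: `β_{n-1} ≤ β_n`, `r_ρ ≤ R_n ≤ V_ρ(R_{n-1}) ≤ R_{n-1}`, and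
`‖x^n - T x^n‖ ≤ κ̂_n R_n ≤ κ̂_n R*_n`. -/
theorem ada_halpern
    {E : Type*} [NormedAddCommGroup E] [NormedSpace ℝ E]
    {C : Set E} (hCne : C.Nonempty) (hCconv : Convex ℝ C)
    {ρ : ℝ} (hρ : 0 < ρ)
    {T : E → E} (hTmaps : Set.MapsTo T C C)
    (hTlip : ∀ x ∈ C, ∀ y ∈ C, ‖T x - T y‖ ≤ ρ * ‖x - y‖)
    (x : ℕ → E) (hx0 : x 0 ∈ C) (hfix : T (x 0) ≠ x 0)
    (β R κ : ℕ → ℝ)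
    (hβ0 : β 0 = 0) (hR0 : R 0 = 1) (hκ0 : κ 0 = ‖x 0 - T (x 0)‖)
    (hβ : ∀ n : ℕ, β (n + 1) = Bq ρ (R n))
    (hx : ∀ n : ℕ, x (n + 1) = (1 - β (n + 1)) • x 0 + β (n + 1) • T (x n))
    (hκ : ∀ n : ℕ, κ (n + 1) = max (κ n) ‖x 0 - T (x (n + 1))‖)
    (hR : ∀ n : ℕ, R (n + 1) =
      1 - β (n + 1) + β (n + 1) * ‖T (x (n + 1)) - T (x n)‖ / κ (n + 1)) :
    ∀ n : ℕ,
      β n ≤ β (n + 1) ∧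
      max 0 (1 - 1 / ρ) ≤ R (n + 1) ∧
      R (n + 1) ≤ Vq ρ (R n) ∧ Vq ρ (R n) ≤ R n ∧
      ‖x (n + 1) - T (x (n + 1))‖ ≤ κ (n + 1) * R (n + 1) ∧
      κ (n + 1) * R (n + 1) ≤ κ (n + 1) * RStar ρ (n + 1) := by
  have hκpos : ∀ n, 0 < κ n := by
    intro n
    induction n with
    | zero => rw [hκ0]; exact norm_pos_iff.2 (sub_ne_zero.2 hfix.symm)
    | succ n ih => rw [hκ]; exact lt_max_of_lt_left ih
  have hκmono : ∀ n, κ n ≤ κ (n + 1) := fun n => by rw [hκ]; exact le_max_left _ _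
  have hκge : ∀ n, ‖x 0 - T (x n)‖ ≤ κ n := by
    rintro (_ | n)
    · exact hκ0.ge
    · rw [hκ]; exact le_max_right _ _
  have hκR : ∀ n, κ (n + 1) * R (n + 1) =
      (1 - β (n + 1)) * κ (n + 1) + β (n + 1) * ‖T (x (n + 1)) - T (x n)‖ := fun n => by
    have := (hκpos (n + 1)).ne'
    rw [hR]
    field_simp
  have hβ1 : ∀ n, β (n + 1) ≤ 1 := fun n => by rw [hβ]; exact min_le_left _ _
  have hstep : ∀ n, x n ∈ C → max 0 (1 - 1 / ρ) ≤ R n → R n ≤ 1 →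
      ‖x (n + 1) - x n‖ ≤ κ n * (β (n + 1) - 1 + R n) →
      x (n + 1) ∈ C ∧ max 0 (1 - 1 / ρ) ≤ R (n + 1) ∧ R (n + 1) ≤ Vq ρ (R n) ∧
      β (n + 1) ≤ β (n + 2) ∧
      ‖x (n + 2) - x (n + 1)‖ ≤ κ (n + 1) * (β (n + 2) - 1 + R (n + 1)) := by
    intro n hxC hr hR1 hd
    have hb0 : 0 ≤ β (n + 1) := by rw [hβ]; exact Bq_nonneg hρ hR1
    have hxC' : x (n + 1) ∈ C := by
      rw [hx]
      exact hCconv hx0 (hTmaps hxC) (by linarith [hβ1 n]) hb0 (by ring)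
    have hlow : 1 - β (n + 1) ≤ R (n + 1) := by
      rw [hR, le_add_iff_nonneg_right]
      have := (hκpos (n + 1)).le
      positivity
    have hbρ : β (n + 1) ≤ 1 / ρ := by
      rw [hβ]
      refine (min_le_right _ _).trans ?_
      linarith [le_max_right 0 (1 - 1 / ρ)]
    have hV : R (n + 1) ≤ Vq ρ (R n) := by
      refine le_trans ?_ (quadratic_Bq_le_Vq hρ (R n))
      rw [← hβ]
      have hs : 0 ≤ β (n + 1) - 1 + R n :=
        nonneg_of_mul_nonneg_right ((norm_nonneg _).trans hd) (hκpos n)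
      have hT : ‖T (x (n + 1)) - T (x n)‖ ≤ ρ * (κ (n + 1) * (β (n + 1) - 1 + R n)) := by
        refine (hTlip _ hxC' _ hxC).trans ?_
        gcongr
        exact hd.trans (by gcongr; exact hκmono n)
      refine le_of_mul_le_mul_left ?_ (hκpos (n + 1))
      rw [hκR]
      linarith [mul_le_mul_of_nonneg_left hT hb0]
    have hRR : R (n + 1) ≤ R n :=
      hV.trans (Vq_le_self ρ ((le_max_left _ _).trans hr) hR1)
    have hbb : β (n + 1) ≤ β (n + 2) := by
      rw [hβ, hβ]
      exact Bq_antitone ρ hRR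
    refine ⟨hxC', max_le (by linarith [hβ1 n]) (by linarith), hV, hbb, ?_⟩
    have hdiff : x (n + 2) - x (n + 1) = (β (n + 2) - β (n + 1)) • (T (x (n + 1)) - x 0) +
        β (n + 1) • (T (x (n + 1)) - T (x n)) := by
      rw [hx (n + 1), hx n]
      module
    have hge := hκge (n + 1)
    rw [norm_sub_rev] at hge
    calc ‖x (n + 2) - x (n + 1)‖
        ≤ (β (n + 2) - β (n + 1)) * ‖T (x (n + 1)) - x 0‖ +
            β (n + 1) * ‖T (x (n + 1)) - T (x n)‖ := by
          rw [hdiff]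
          refine (norm_add_le _ _).trans_eq ?_
          rw [norm_smul, norm_smul, Real.norm_of_nonneg (sub_nonneg.2 hbb),
            Real.norm_of_nonneg hb0]
      _ ≤ (β (n + 2) - β (n + 1)) * κ (n + 1) +
            β (n + 1) * ‖T (x (n + 1)) - T (x n)‖ := by
          have := sub_nonneg.2 hbb
          gcongr
      _ = κ (n + 1) * (β (n + 2) - 1 + R (n + 1)) := by linarith [hκR n]
  have hinv : ∀ n, x n ∈ C ∧ max 0 (1 - 1 / ρ) ≤ R n ∧ R n ≤ 1 ∧ R n ≤ RStar ρ n ∧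
      β n ≤ β (n + 1) ∧ ‖x (n + 1) - x n‖ ≤ κ n * (β (n + 1) - 1 + R n) := by
    intro n
    induction n with
    | zero =>
      have hb : 0 ≤ β (0 + 1) := by rw [hβ]; exact Bq_nonneg hρ hR0.le
      have hρ' : 0 < 1 / ρ := by positivity
      refine ⟨hx0, ?_, hR0.le, hR0.le, hβ0.trans_le hb, ?_⟩
      · rw [hR0]
        exact max_le zero_le_one (by linarith)
      · have hdiff : x (0 + 1) - x 0 = β (0 + 1) • (T (x 0) - x 0) := by
          rw [hx 0]
          module
        rw [hdiff, norm_smul, Real.norm_of_nonneg hb, norm_sub_rev, hκ0, hR0]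
        exact le_of_eq (by ring)
    | succ n ih =>
      obtain ⟨hxC, hr, hR1, hRs, -, hd⟩ := ih
      obtain ⟨hxC', hr', hV, hb', hd'⟩ := hstep n hxC hr hR1 hd
      exact ⟨hxC', hr',
        (hV.trans (Vq_le_self ρ ((le_max_left _ _).trans hr) hR1)).trans hR1,
        hV.trans (Vq_mono hρ hRs), hb', hd'⟩
  intro n
  obtain ⟨hxC, hr, hR1, -, hb, hd⟩ := hinv n
  obtain ⟨-, hr', hV, -, -⟩ := hstep n hxC hr hR1 hd
  refine ⟨hb, hr', hV, Vq_le_self ρ ((le_max_left _ _).trans hr) hR1, ?_,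
    mul_le_mul_of_nonneg_left (hinv (n + 1)).2.2.2.1 (hκpos _).le⟩
  have hb0 : 0 ≤ β (n + 1) := by rw [hβ]; exact Bq_nonneg hρ hR1
  have hb1 := sub_nonneg.2 (hβ1 n)
  have hdiff : x (n + 1) - T (x (n + 1)) = (1 - β (n + 1)) • (x 0 - T (x (n + 1))) +
      β (n + 1) • (T (x n) - T (x (n + 1))) := by
    nth_rewrite 1 [hx n]
    module
  rw [hκR, hdiff]
  refine (norm_add_le _ _).trans ?_
  rw [norm_smul, norm_smul, Real.norm_of_nonneg hb1, Real.norm_of_nonneg hb0,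
    norm_sub_rev (T (x n))]
  gcongr
  exact hκge (n + 1)
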